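/- arXiv:2310.20221 — 9 statements merged into one kernel-verified Lean document; each statement's English description precedes it below -/
import Mathlib

section
/- The spiral enumeration t, restricted to indices k ≥ 1, is a bijection from {k ∈ ℕ : k ≥ 1} onto ℤ×ℤ. -/
namespace Spiral

/-- The origin. -/
def O : Set (ℤ × ℤ) := {p | p = (0, 0)}
/-- ℓ1 = {(x, −(x−1)) : x > 0}. -/
def l1 : Set (ℤ × ℤ) := {p | 0 < p.1 ∧ p.2 = -(p.1 - 1)}
/-- ℓ2 = {(x, x) : x > 0}. -/
def l2 : Set (ℤ × ℤ) := {p | 0 < p.1 ∧ p.2 = p.1}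
/-- ℓ3 = {(−x, x) : x > 0}. -/
def l3 : Set (ℤ × ℤ) := {p | 0 < p.2 ∧ p.1 = -p.2}
/-- ℓ4 = {(−x, −x) : x > 0}. -/
def l4 : Set (ℤ × ℤ) := {p | p.1 < 0 ∧ p.2 = p.1}
/-- D1 = {(x,y) : x > 1 and −(x−1) < y < x}. -/
def D1 : Set (ℤ × ℤ) := {p | 1 < p.1 ∧ -(p.1 - 1) < p.2 ∧ p.2 < p.1}
/-- D2 = {(x,y) : y > 0 and −y < x < y}. -/
def D2 : Set (ℤ × ℤ) := {p | 0 < p.2 ∧ -p.2 < p.1 ∧ p.1 < p.2}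
/-- D3 = {(x,y) : x < 0 and x < y < −x}. -/
def D3 : Set (ℤ × ℤ) := {p | p.1 < 0 ∧ p.1 < p.2 ∧ p.2 < -p.1}
/-- D4 = {(x,y) : y < 0 and y < x < −y+1}. -/
def D4 : Set (ℤ × ℤ) := {p | p.2 < 0 ∧ p.2 < p.1 ∧ p.1 < -p.2 + 1}

open scoped Classical in
/-- The step of the spiral at a point. -/
noncomputable def step (p : ℤ × ℤ) : ℤ × ℤ :=
  if p ∈ l1 ∪ D1 then (0, 1)
  else if p ∈ l2 ∪ D2 then (-1, 0)
  else if p ∈ l3 ∪ D3 then (0, -1)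
  else (1, 0)

/-- The spiral enumeration `t` (meaningful for indices `k ≥ 1`):
`t 1 = (0,0)` and `t (k+1) = t k + step (t k)` for `k ≥ 1`. -/
noncomputable def t : ℕ → ℤ × ℤ
  | 0 => (0, 0)
  | 1 => (0, 0)
  | k + 2 => t (k + 1) + step (t (k + 1))

end Spiral

namespace Spiral

/-- The position of a lattice point along the spiral, computed side by side. -/
def index (p : ℤ × ℤ) : ℤ :=
  if 0 < p.1 ∧ -(p.1 - 1) ≤ p.2 ∧ p.2 ≤ p.1 then 4 * p.1 ^ 2 - 3 * p.1 + 1 + p.2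
  else if 0 < p.2 ∧ -p.2 ≤ p.1 ∧ p.1 ≤ p.2 then 4 * p.2 ^ 2 - p.2 + 1 - p.1
  else if p.1 < 0 ∧ p.1 ≤ p.2 ∧ p.2 ≤ -p.1 then 4 * p.1 ^ 2 - p.1 + 1 - p.2
  else 4 * p.2 ^ 2 - 3 * p.2 + 1 + p.1

theorem step_mk (x y : ℤ) : step (x, y) =
    if 0 < x ∧ -(x - 1) ≤ y ∧ y < x then (0, 1)
    else if 0 < y ∧ -y < x ∧ x ≤ y then (-1, 0)
    else if x < 0 ∧ x < y ∧ y ≤ -x then (0, -1)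
    else (1, 0) := by
  simp only [step, l1, l2, l3, D1, D2, D3, Set.mem_union, Set.mem_ofPred_eq]
  split_ifs <;> first | rfl | omega

theorem index_pos (p : ℤ × ℤ) : 1 ≤ index p := by
  obtain ⟨x, y⟩ := p
  simp only [index]
  split_ifs
  · nlinarith
  · nlinarith
  · nlinarith
  · have : y ≤ x ∧ y ≤ 0 := by omega
    nlinarith

theorem index_add_step (p : ℤ × ℤ) : index (p + step p) = index p + 1 := by
  obtain ⟨x, y⟩ := p
  rw [step_mk]
  split_ifs <;> simp only [index, Prod.mk_add_mk] <;> split_ifs <;>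
    first
    | (exfalso; omega)
    | ring1
    | (have h : x = y := by omega
       subst h
       ring1)
    | (have h : x = -y := by omega
       subst h
       ring1)

theorem exists_add_step_eq {p : ℤ × ℤ} (hp : p ≠ (0, 0)) : ∃ q, q + step q = p := by
  obtain ⟨x, y⟩ := p
  have hxy : ¬(x = 0 ∧ y = 0) := by simpa using hp
  by_cases hright : 0 < x ∧ -(x - 1) < y ∧ y ≤ x
  · refine ⟨(x, y - 1), ?_⟩
    rw [step_mk, if_pos (by omega)]
    simp
  by_cases htop : 0 < y ∧ -y ≤ x ∧ x < y
  · refine ⟨(x + 1, y), ?_⟩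
    rw [step_mk, if_neg (by omega), if_pos (by omega)]
    simp
  by_cases hleft : x < 0 ∧ x ≤ y ∧ y < -x
  · refine ⟨(x, y + 1), ?_⟩
    rw [step_mk, if_neg (by omega), if_neg (by omega), if_pos (by omega)]
    simp
  · refine ⟨(x - 1, y), ?_⟩
    rw [step_mk, if_neg (by omega), if_neg (by omega), if_neg (by omega)]
    simp

theorem index_t (k : ℕ) : index (t (k + 1)) = k + 1 := by
  induction k with
  | zero => simp [t, index]
  | succ k ih => rw [t, index_add_step, ih]; push_cast; ring

theorem t_succ_eq_of_index (n : ℕ) (p : ℤ × ℤ) (hp : index p = n + 1) : t (n + 1) = p := by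
  induction n generalizing p with
  | zero =>
    by_contra hne
    obtain ⟨q, rfl⟩ := exists_add_step_eq (p := p) fun h => hne (by simp [t, h])
    have := index_pos q
    rw [index_add_step] at hp
    omega
  | succ n ih =>
    have hne : p ≠ (0, 0) := by
      rintro rfl
      norm_num [index] at hp
      omega
    obtain ⟨q, rfl⟩ := exists_add_step_eq hne
    rw [index_add_step] at hp
    rw [t, ih q (by push_cast at hp; omega)]

end Spiral

open Spiral in
/-- The spiral enumeration `t`, restricted to indices `k ≥ 1`,
is a bijection onto ℤ×ℤ. -/
theorem spiral_bijOn : Set.BijOn t {k : ℕ | 1 ≤ k} Set.univ := by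
  refine ⟨fun _ _ => Set.mem_univ _, fun j hj k hk hjk => ?_, fun p _ => ?_⟩
  · obtain ⟨j, rfl⟩ := Nat.exists_eq_add_of_le' hj
    obtain ⟨k, rfl⟩ := Nat.exists_eq_add_of_le' hk
    have h := congrArg index hjk
    rw [index_t, index_t] at h
    omega
  · have := index_pos p
    exact ⟨(index p - 1).toNat + 1, Nat.le_add_left _ _, t_succ_eq_of_index _ _ (by omega)⟩
end

section
/- For every k ≥ 1 and every integer x ≥ 1, if t(k) = (x, −(x−1)) (i.e., t(k) ∈ ℓ1), then t(m) ∈ D1 for all m with k < m < k + (2x−1), and t(k + (2x−1)) = (x, x). -/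
namespace Spiral

theorem t_succ {k : ℕ} (hk : 1 ≤ k) : t (k + 1) = t k + step (t k) := by
  obtain ⟨n, rfl⟩ := Nat.exists_eq_add_of_le' hk
  rfl

theorem step_eq_up {x y : ℤ} (hx : 0 < x) (hy : -(x - 1) ≤ y) (hyx : y < x) :
    step (x, y) = (0, 1) := by
  refine if_pos ?_
  simp only [l1, D1, Set.mem_union, Set.mem_ofPred_eq]
  omega

/-- Starting on `ℓ1`, the spiral moves straight up until it reaches the diagonal `ℓ2`. -/
theorem t_add_of_mem_l1 {k : ℕ} {x : ℤ} (hk : 1 ≤ k) (hx : 0 < x)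
    (h : t k = (x, -(x - 1))) (j : ℕ) (hj : (j : ℤ) ≤ 2 * x - 1) :
    t (k + j) = (x, -(x - 1) + j) := by
  induction j with
  | zero => simpa using h
  | succ j ih =>
    push_cast at hj
    rw [← add_assoc, t_succ (by omega), ih (by omega),
      step_eq_up hx (by omega) (by omega)]
    simp [add_assoc]

end Spiral

open Spiral in
/-- If `t k ∈ ℓ1`, say `t k = (x, −(x−1))`, then the next `2x−2` points lie in `D1`
and `t (k + (2x−1)) = (x, x) ∈ ℓ2`. -/
theorem spiral_l1_to_l2 (k x : ℕ) (hk : 1 ≤ k) (hx : 1 ≤ x)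
    (h : t k = ((x : ℤ), -((x : ℤ) - 1))) :
    (∀ m : ℕ, k < m → m < k + (2 * x - 1) → t m ∈ D1) ∧
      t (k + (2 * x - 1)) = ((x : ℤ), (x : ℤ)) := by
  have hx' : (0 : ℤ) < x := by omega
  refine ⟨fun m hkm hm => ?_, ?_⟩
  · obtain ⟨j, rfl⟩ := Nat.exists_eq_add_of_lt hkm
    rw [add_assoc, t_add_of_mem_l1 hk hx' h (j + 1) (by omega)]
    simp only [D1, Set.mem_ofPred_eq]
    omega
  · rw [t_add_of_mem_l1 hk hx' h _ (by omega), Prod.mk.injEq]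
    omega
end

section
/- For every k ≥ 1 and every integer x ≥ 1, if t(k) = (x, x) (i.e., t(k) ∈ ℓ2), then t(m) ∈ D2 for all m with k < m < k + 2x, and t(k + 2x) = (−x, x). -/
namespace Spiral

/-- On the top side of the square of radius `y`, left corner excluded, the spiral moves left. -/
theorem step_of_top {a y : ℤ} (hl : -y < a) (hr : a ≤ y) : step (a, y) = (-1, 0) := by
  have h1 : (a, y) ∉ l1 ∪ D1 := by
    simp only [l1, D1, Set.mem_union, Set.mem_ofPred_eq]
    omega
  have h2 : (a, y) ∈ l2 ∪ D2 := by
    simp only [l2, D2, Set.mem_union, Set.mem_ofPred_eq]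
    omega
  rw [step, if_neg h1, if_pos h2]

/-- From the corner `(x, x)` the spiral runs leftwards along the top side. -/
theorem t_add_of_corner {k x : ℕ} (hk : 1 ≤ k) (h : t k = ((x : ℤ), (x : ℤ))) {j : ℕ}
    (hj : j ≤ 2 * x) : t (k + j) = ((x : ℤ) - j, (x : ℤ)) := by
  induction j with
  | zero => simpa using h
  | succ j ih =>
    rw [← add_assoc, t_succ (by omega), ih (by omega), step_of_top (by omega) (by omega)]
    ext <;> simp
    ring

end Spiral

open Spiral in
/-- If `t k ∈ ℓ2`, say `t k = (x, x)`, then the next `2x−1` points lie in `D2`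
and `t (k + 2x) = (−x, x) ∈ ℓ3`. -/
theorem spiral_l2_to_l3 (k x : ℕ) (hk : 1 ≤ k) (hx : 1 ≤ x)
    (h : t k = ((x : ℤ), (x : ℤ))) :
    (∀ m : ℕ, k < m → m < k + 2 * x → t m ∈ D2) ∧
      t (k + 2 * x) = (-(x : ℤ), (x : ℤ)) := by
  constructor
  · intro m hkm hm
    obtain ⟨j, rfl⟩ := Nat.exists_eq_add_of_lt hkm
    rw [add_assoc, t_add_of_corner hk h (by omega)]
    simp only [D2, Set.mem_ofPred_eq]
    omega
  · rw [t_add_of_corner hk h le_rfl]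
    ext <;> simp
    ring
end

section
/- For every k ≥ 1 and every integer x ≥ 1, if t(k) = (−x, x) (i.e., t(k) ∈ ℓ3), then t(m) ∈ D3 for all m with k < m < k + 2x, and t(k + 2x) = (−x, −x). -/
namespace Spiral

theorem step_of_mem_l3_union_D3 {p : ℤ × ℤ} (hp : p ∈ l3 ∪ D3) : step p = (0, -1) := by
  have h₁ : p ∉ l1 ∪ D1 := by
    simp only [l1, l3, D1, D3, Set.mem_union, Set.mem_ofPred_eq] at hp ⊢
    omega
  have h₂ : p ∉ l2 ∪ D2 := by
    simp only [l2, l3, D2, D3, Set.mem_union, Set.mem_ofPred_eq] at hp ⊢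
    omega
  rw [step, if_neg h₁, if_neg h₂, if_pos hp]

/-- From `(-x, x)` the spiral descends along the left side of the square. -/
theorem t_add_of_eq_l3 {k x : ℕ} (hk : 1 ≤ k) (h : t k = (-(x : ℤ), (x : ℤ))) {j : ℕ}
    (hj : j ≤ 2 * x) : t (k + j) = (-(x : ℤ), (x : ℤ) - j) := by
  induction j with
  | zero => simpa using h
  | succ j ih =>
    have hmem : (-(x : ℤ), (x : ℤ) - j) ∈ l3 ∪ D3 := by
      simp only [l3, D3, Set.mem_union, Set.mem_ofPred_eq]
      omega
    rw [← add_assoc, t_succ (by omega), ih (by omega), step_of_mem_l3_union_D3 hmem]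
    ext <;> push_cast <;> simp only [Prod.mk_add_mk] <;> ring

end Spiral

open Spiral in
/-- If `t k ∈ ℓ3`, say `t k = (−x, x)`, then the next `2x−1` points lie in `D3`
and `t (k + 2x) = (−x, −x) ∈ ℓ4`. -/
theorem spiral_l3_to_l4 (k x : ℕ) (hk : 1 ≤ k) (hx : 1 ≤ x)
    (h : t k = (-(x : ℤ), (x : ℤ))) :
    (∀ m : ℕ, k < m → m < k + 2 * x → t m ∈ D3) ∧
      t (k + 2 * x) = (-(x : ℤ), -(x : ℤ)) := by
  refine ⟨fun m hkm hm => ?_, ?_⟩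
  · obtain ⟨j, rfl⟩ := Nat.exists_eq_add_of_le hkm.le
    rw [t_add_of_eq_l3 hk h (by omega)]
    simp only [D3, Set.mem_ofPred_eq]
    omega
  · rw [t_add_of_eq_l3 hk h le_rfl]
    ext <;> push_cast <;> ring
end

section
/- For every k ≥ 1 and every integer x ≥ 1, if t(k) = (−x, −x) (i.e., t(k) ∈ ℓ4), then t(m) ∈ D4 for all m with k < m < k + (2x+1), and t(k + (2x+1)) = (x+1, −x). -/
namespace Spiral

theorem step_of_mem_l4_union_D4 {p : ℤ × ℤ} (hp : p ∈ l4 ∪ D4) : step p = (1, 0) := by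
  simp only [l4, D4, Set.mem_union, Set.mem_ofPred_eq] at hp
  have h1 : p ∉ l1 ∪ D1 := by
    simp only [l1, D1, Set.mem_union, Set.mem_ofPred_eq]
    omega
  have h2 : p ∉ l2 ∪ D2 := by
    simp only [l2, D2, Set.mem_union, Set.mem_ofPred_eq]
    omega
  have h3 : p ∉ l3 ∪ D3 := by
    simp only [l3, D3, Set.mem_union, Set.mem_ofPred_eq]
    omega
  rw [step, if_neg h1, if_neg h2, if_neg h3]

/-- Starting from `(-x, -x)`, the spiral moves right along the bottom edge. -/
theorem t_add_of_eq_neg_neg {k x : ℕ} (hk : 1 ≤ k) (hx : 1 ≤ x)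
    (h : t k = (-(x : ℤ), -(x : ℤ))) {j : ℕ} (hj : j ≤ 2 * x + 1) :
    t (k + j) = (-(x : ℤ) + j, -(x : ℤ)) := by
  induction j with
  | zero => simpa using h
  | succ j ih =>
    have hmem : (-(x : ℤ) + j, -(x : ℤ)) ∈ l4 ∪ D4 := by
      simp only [l4, D4, Set.mem_union, Set.mem_ofPred_eq]
      omega
    rw [← add_assoc, t_succ (by omega), ih (by omega), step_of_mem_l4_union_D4 hmem]
    simp [add_assoc]

end Spiral

open Spiral in
/-- If `t k ∈ ℓ4`, say `t k = (−x, −x)`, then the next `2x` points lie in `D4`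
and `t (k + (2x+1)) = (x+1, −x) ∈ ℓ1`. -/
theorem spiral_l4_to_l1 (k x : ℕ) (hk : 1 ≤ k) (hx : 1 ≤ x)
    (h : t k = (-(x : ℤ), -(x : ℤ))) :
    (∀ m : ℕ, k < m → m < k + (2 * x + 1) → t m ∈ D4) ∧
      t (k + (2 * x + 1)) = ((x : ℤ) + 1, -(x : ℤ)) := by
  refine ⟨fun m hkm hm => ?_, ?_⟩
  · obtain ⟨j, rfl⟩ := Nat.exists_eq_add_of_le hkm.le
    rw [t_add_of_eq_neg_neg hk hx h (by omega)]
    simp only [D4, Set.mem_ofPred_eq]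
    omega
  · rw [t_add_of_eq_neg_neg hk hx h le_rfl]
    ext
    · push_cast
      ring
    · rfl
end

section
/- For every k ≥ 1, if t(k) = (x, y) ∈ ℓ1 ∪ D1 ∪ ℓ2, then t(k + (8x+1)) = (x+1, y). (Equivalently, with i = x−1 the number of completed turns of the spiral, the index of the point one step to the right of t(k) is k + (8i+9).) -/
namespace Spiral

/-- As long as the step is constant along a straight run, the spiral follows that run. -/
theorem t_add_of_step_eq {k : ℕ} (hk : 1 ≤ k) {p d : ℤ × ℤ} (h : t k = p) (n : ℕ)
    (hstep : ∀ m < n, step (p + m • d) = d) : t (k + n) = p + n • d := by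
  induction n with
  | zero => simpa using h
  | succ n ih =>
    have hn := ih fun m hm => hstep m (by omega)
    rw [← add_assoc, t_succ (by omega), hn, hstep n (by omega), succ_nsmul, add_assoc]

theorem step_up {x y : ℤ} (hx : 0 < x) (h₁ : -(x - 1) ≤ y) (h₂ : y < x) :
    step (x, y) = (0, 1) := by
  simp only [step, l1, D1, Set.mem_union, Set.mem_ofPred_eq]
  rw [if_pos (by omega)]

theorem step_left {x y : ℤ} (hy : 0 < y) (h₁ : -y < x) (h₂ : x ≤ y) :
    step (x, y) = (-1, 0) := by
  simp only [step, l1, D1, l2, D2, Set.mem_union, Set.mem_ofPred_eq]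
  rw [if_neg (by omega), if_pos (by omega)]

theorem step_down {x y : ℤ} (hx : x < 0) (h₁ : x < y) (h₂ : y ≤ -x) :
    step (x, y) = (0, -1) := by
  simp only [step, l1, D1, l2, D2, l3, D3, Set.mem_union, Set.mem_ofPred_eq]
  rw [if_neg (by omega), if_neg (by omega), if_pos (by omega)]

theorem step_right {x y : ℤ} (hy : y < 0) (h₁ : y ≤ x) (h₂ : x < -y + 1) :
    step (x, y) = (1, 0) := by
  simp only [step, l1, D1, l2, D2, l3, D3, Set.mem_union, Set.mem_ofPred_eq]
  rw [if_neg (by omega), if_neg (by omega), if_neg (by omega)]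

theorem t_add_up {k : ℕ} (hk : 1 ≤ k) {x y : ℤ} (h : t k = (x, y)) (n : ℕ) (hx : 0 < x)
    (h₁ : -(x - 1) ≤ y) (h₂ : y + n ≤ x) : t (k + n) = (x, y + n) := by
  simpa using t_add_of_step_eq hk (d := (0, 1)) h n fun m hm => by
    simpa using step_up (x := x) (y := y + m) hx (by omega) (by omega)

theorem t_add_left {k : ℕ} (hk : 1 ≤ k) {x y : ℤ} (h : t k = (x, y)) (n : ℕ) (hy : 0 < y)
    (h₁ : -y ≤ x - n) (h₂ : x ≤ y) : t (k + n) = (x - n, y) := by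
  simpa [sub_eq_add_neg] using t_add_of_step_eq hk (d := (-1, 0)) h n fun m hm => by
    simpa [sub_eq_add_neg] using step_left (x := x - m) (y := y) hy (by omega) (by omega)

theorem t_add_down {k : ℕ} (hk : 1 ≤ k) {x y : ℤ} (h : t k = (x, y)) (n : ℕ) (hx : x < 0)
    (h₁ : x ≤ y - n) (h₂ : y ≤ -x) : t (k + n) = (x, y - n) := by
  simpa [sub_eq_add_neg] using t_add_of_step_eq hk (d := (0, -1)) h n fun m hm => by
    simpa [sub_eq_add_neg] using step_down (x := x) (y := y - m) hx (by omega) (by omega)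

theorem t_add_right {k : ℕ} (hk : 1 ≤ k) {x y : ℤ} (h : t k = (x, y)) (n : ℕ) (hy : y < 0)
    (h₁ : y ≤ x) (h₂ : x + n ≤ -y + 1) : t (k + n) = (x + n, y) := by
  simpa using t_add_of_step_eq hk (d := (1, 0)) h n fun m hm => by
    simpa using step_right (x := x + m) (y := y) hy (by omega) (by omega)

end Spiral

open Spiral in
/-- If `t k = (x, y) ∈ ℓ1 ∪ D1 ∪ ℓ2`, then the point one step to the right of `t k`
has index `k + (8x + 1)` in the spiral enumeration. -/
theorem spiral_right_index_l1D1l2 (k : ℕ) (hk : 1 ≤ k) (x y : ℤ)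
    (h : t k = (x, y)) (hm : (x, y) ∈ l1 ∪ D1 ∪ l2) :
    t (k + (8 * x.toNat + 1)) = (x + 1, y) := by
  simp only [l1, D1, l2, Set.mem_union, Set.mem_ofPred_eq] at hm
  have hx : 0 < x := by omega
  have hy : -(x - 1) ≤ y ∧ y ≤ x := by omega
  lift x to ℕ using hx.le
  obtain ⟨a, ha⟩ : ∃ a : ℕ, (a : ℤ) = x - y := ⟨(x - y).toNat, by omega⟩
  obtain ⟨b, hb⟩ : ∃ b : ℕ, (b : ℤ) = x + y := ⟨(x + y).toNat, by omega⟩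
  have h_up := t_add_up hk h a hx hy.1 (by omega)
  have h_left := t_add_left (by omega) h_up (2 * x) (by omega) (by omega) (by omega)
  have h_down := t_add_down (by omega) h_left (2 * x) (by omega) (by omega) (by omega)
  have h_right := t_add_right (by omega) h_down (2 * x + 1) (by omega) (by omega) (by omega)
  have h_end := t_add_up (by omega) h_right b (by omega) (by omega) (by omega)
  convert h_end using 2 <;> grind
end

section
/- For every k ≥ 1, if t(k) = (x, y) ∈ D2 ∪ ℓ3, then k ≥ 2 and t(k − 1) = (x+1, y); that is, the point one step to the right of t(k) occurs exactly one position earlier in the spiral enumeration. -/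
/-- A step of the spiral can only enter `D2 ∪ l3` from the right. -/
theorem Spiral.eq_of_add_step_mem_D2_union_l3 {p : ℤ × ℤ} {x y : ℤ}
    (h : p + step p = (x, y)) (hm : (x, y) ∈ D2 ∪ l3) : p = (x + 1, y) := by
  obtain ⟨a, b⟩ := p
  unfold step at h
  simp only [l1, l2, l3, D1, D2, D3, Set.mem_union, Set.mem_ofPred_eq] at h hm
  split_ifs at h <;> simp only [Prod.mk_add_mk, Prod.mk.injEq] at h ⊢ <;> omega

open Spiral in
/-- If `t k = (x, y) ∈ D2 ∪ ℓ3`, then `k ≥ 2` and the point one step to the right of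
`t k` occurs exactly one position earlier in the spiral enumeration. -/
theorem spiral_right_index_D2l3 (k : ℕ) (hk : 1 ≤ k) (x y : ℤ)
    (h : t k = (x, y)) (hm : (x, y) ∈ D2 ∪ l3) :
    2 ≤ k ∧ t (k - 1) = (x + 1, y) := by
  match k, hk with
  | 1, _ =>
    simp only [t, Prod.mk.injEq] at h
    simp only [D2, l3, Set.mem_union, Set.mem_ofPred_eq] at hm
    omega
  | k + 2, _ => exact ⟨by omega, eq_of_add_step_mem_D2_union_l3 h hm⟩
end

section
/- Let α and β be finite types and let f : List α → List β be a function such that the graph language {x ⊗ f(x) : x ∈ List α}, viewed as a language over the alphabet Option α × Option β, is regular (accepted by a deterministic finite automaton). Then there exists a constant C ∈ ℕ such that |f(x)| ≤ |x| + C for all x ∈ List α. -/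
/-- The convolution of two strings: the `k`-th entry is the pair of the `k`-th entries of
`x` and `z`, with `none` used as padding past the end of the shorter string. -/
def conv {α β : Type} (x : List α) (z : List β) : List (Option α × Option β) :=
  List.ofFn fun i : Fin (max x.length z.length) => (x[i.1]?, z[i.1]?)

theorem length_conv {α β : Type} (x : List α) (z : List β) :
    (conv x z).length = max x.length z.length := by
  simp [conv]

theorem map_fst_conv {α β : Type} (x : List α) (z : List β) :
    (conv x z).map Prod.fst = x.map some ++ List.replicate (z.length - x.length) none := by
  apply List.ext_getElem
  · simp [length_conv]; omega
  · intro i h₁ h₂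
    by_cases hi : i < x.length
    · simp [conv, hi]
    · simp [conv, hi, not_lt.mp hi]

theorem filterMap_fst_conv {α β : Type} (x : List α) (z : List β) :
    (conv x z).filterMap Prod.fst = x := by
  have h := congrArg (List.filterMap id) (map_fst_conv x z)
  simpa [List.filterMap_map, List.filterMap_append, List.filterMap_replicate] using h

theorem fst_eq_none_of_mem_drop_conv {α β : Type} (x : List α) (z : List β)
    {e : Option α × Option β} (he : e ∈ (conv x z).drop x.length) : e.1 = none := by
  have h : e.1 ∈ ((conv x z).map Prod.fst).drop x.length := by
    rw [← List.map_drop]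
    exact List.mem_map_of_mem he
  rw [map_fst_conv, List.drop_left' (by simp)] at h
  exact List.eq_of_mem_replicate h

/-- If the graph language of `f : List α → List β` is regular, then
`|f x| ≤ |x| + C` for some constant `C`. -/
theorem length_le_of_graph_regular {α β : Type} [Fintype α] [Fintype β]
    (f : List α → List β)
    (h : Language.IsRegular
      {w : List (Option α × Option β) | ∃ x : List α, w = conv x (f x)}) :
    ∃ C : ℕ, ∀ x : List α, (f x).length ≤ x.length + C := by
  obtain ⟨σ, _, M, hM⟩ := h
  have mem_iff : ∀ w, w ∈ M.accepts ↔ ∃ x, w = conv x (f x) := fun w => by rw [hM]; rfl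
  refine ⟨Fintype.card σ, fun x => ?_⟩
  by_contra! hlt
  set p := (conv x (f x)).take x.length
  set t := (conv x (f x)).drop x.length with ht
  have hpt : conv x (f x) = p ++ t := (List.take_append_drop _ _).symm
  have ht_len : Fintype.card σ ≤ t.length := by
    rw [ht, List.length_drop, length_conv]; omega
  obtain ⟨q, a, b, c, habc, -, hb, ha_eval, -, hc_eval⟩ :=
    M.evalFrom_split (s := M.eval p) ht_len rfl
  have hacc : p ++ t ∈ M.accepts := (mem_iff _).2 ⟨x, hpt.symm⟩
  have hcut : p ++ (a ++ c) ∈ M.accepts := by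
    rw [DFA.mem_accepts, DFA.eval, DFA.evalFrom_of_append] at hacc ⊢
    rw [DFA.evalFrom_of_append]
    change M.evalFrom (M.evalFrom (M.eval p) a) c ∈ _
    rw [ha_eval, hc_eval]
    exact hacc
  obtain ⟨y, hy⟩ := (mem_iff _).1 hcut
  have hb_none : b.filterMap Prod.fst = [] :=
    List.filterMap_eq_nil_iff.2 fun e he =>
      fst_eq_none_of_mem_drop_conv x (f x) (by rw [← ht, habc]; simp [he])
  have hyx : y = x := by
    rw [← filterMap_fst_conv y (f y), ← hy, ← filterMap_fst_conv x (f x), hpt, habc]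
    simp [List.filterMap_append, hb_none]
  rw [hyx, hpt, habc] at hy
  have hlen := congrArg List.length hy
  have hb_pos := List.length_pos_iff.2 hb
  simp only [List.length_append] at hlen
  omega
end

section
/- Let G be a group with finite semigroup generating set S, let L ⊆ List Σ be a language over a finite alphabet, and let ψ : L → G be a bijection. Suppose that for each s ∈ S there exist a function f_s : List Σ → List Σ mapping L into L and a constant C_s ∈ ℕ such that ψ(f_s(w)) = ψ(w)·s and |f_s(w)| ≤ |w| + C_s for all w ∈ L. Then ψ is quasigeodesic. -/
/-- The word metric with respect to a semigroup generating set `S`: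
the least length of a word over `S` whose product is `g`. -/
noncomputable def dS {G : Type*} [Group G] (S : Set G) (g : G) : ℕ :=
  sInf {n | ∃ l : List G, (∀ x ∈ l, x ∈ S) ∧ l.prod = g ∧ l.length = n}

/-- A bijection `ψ : L ≃ G` is quasigeodesic (w.r.t. the semigroup generating set `S`) if
for some constant `C > 0` the normal form of every `g ∈ G` has length at most
`C * (dS S g + 1)`. -/
def Quasigeodesic {G : Type*} [Group G] {α : Type*} (S : Set G) (L : Set (List α))
    (ψ : L ≃ G) : Prop :=
  ∃ C : ℕ, 0 < C ∧ ∀ g : G, (ψ.symm g : List α).length ≤ C * (dS S g + 1)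

/-- If right multiplication by each `s ∈ S` increases a length function by at most `C`, then
right multiplication by a product of `n` elements of `S` increases it by at most `C * n`. -/
theorem length_mul_prod_le {G : Type*} [Monoid G] {S : Set G} {len : G → ℕ} {C : ℕ}
    (hlen : ∀ s ∈ S, ∀ g, len (g * s) ≤ len g + C) (l : List G) (hl : ∀ x ∈ l, x ∈ S) (g : G) :
    len (g * l.prod) ≤ len g + C * l.length := by
  induction l generalizing g with
  | nil => simp
  | cons a l ih =>
    have hprod := ih (fun x hx => hl x (List.mem_cons_of_mem _ hx)) (g * a)
    have hhead := hlen a (hl a List.mem_cons_self) g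
    rw [List.prod_cons, ← mul_assoc, List.length_cons, mul_add, mul_one]
    omega

/-- The word length `dS S g` is attained whenever `g` is a product of elements of `S`. -/
theorem exists_list_length_eq_dS {G : Type*} [Group G] {S : Set G} {g : G}
    (hg : ∃ l : List G, (∀ x ∈ l, x ∈ S) ∧ l.prod = g) :
    ∃ l : List G, (∀ x ∈ l, x ∈ S) ∧ l.prod = g ∧ l.length = dS S g := by
  obtain ⟨l, hl, hprod⟩ := hg
  exact Nat.sInf_mem (s := {n | ∃ l : List G, (∀ x ∈ l, x ∈ S) ∧ l.prod = g ∧ l.length = n})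
    ⟨l.length, l, hl, hprod, rfl⟩

/-- If a bijective representation `ψ : L ≃ G` admits, for each generator `s ∈ S`, a
right-multiplication function `f_s` on normal forms increasing the length by at most a
constant, then `ψ` is quasigeodesic. -/
theorem quasigeodesic_of_bounded_length_increase {G : Type} [Group G] {α : Type} [Fintype α]
    (S : Finset G)
    (hgen : ∀ g : G, ∃ l : List G, (∀ x ∈ l, x ∈ S) ∧ l.prod = g)
    (L : Set (List α)) (ψ : L ≃ G)
    (h : ∀ s ∈ S, ∃ (f : List α → List α) (hL : ∀ w ∈ L, f w ∈ L) (C : ℕ),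
      (∀ w : L, ψ ⟨f w.1, hL w.1 w.2⟩ = ψ w * s) ∧
      (∀ w : L, (f w.1).length ≤ (w.1).length + C)) :
    Quasigeodesic (↑S) L ψ := by
  have hstep : ∀ s ∈ S, ∃ C : ℕ, ∀ g : G,
      (ψ.symm (g * s) : List α).length ≤ (ψ.symm g : List α).length + C := by
    intro s hs
    obtain ⟨f, hL, C, hmul, hlen⟩ := h s hs
    refine ⟨C, fun g => ?_⟩
    have hw := hmul (ψ.symm g)
    rw [ψ.apply_symm_apply] at hw
    rw [← hw, ψ.symm_apply_apply]
    exact hlen (ψ.symm g)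
  choose! c hc using hstep
  have hsup : ∀ s ∈ (S : Set G), ∀ g : G,
      (ψ.symm (g * s) : List α).length ≤ (ψ.symm g : List α).length + S.sup c :=
    fun s hs g => (hc s hs g).trans (Nat.add_le_add_left (Finset.le_sup hs) _)
  refine ⟨S.sup c + (ψ.symm 1 : List α).length + 1, by omega, fun g => ?_⟩
  obtain ⟨l, hl, rfl, hlength⟩ := exists_list_length_eq_dS (S := (S : Set G)) (hgen g)
  have hbound := length_mul_prod_le (len := fun g => (ψ.symm g : List α).length) hsup l hl 1
  rw [one_mul] at hbound
  rw [← hlength]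
  nlinarith [hbound, Nat.zero_le ((ψ.symm 1 : List α).length * l.length)]
end
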